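/- Let Σ ∈ ℝ^{d×d} be symmetric positive definite and y ∈ ℝ^d. Fix 0 < ε < 1/‖Σ‖_op, where ‖Σ‖_op is the largest eigenvalue of Σ. Then there exist constants c₁, c₂ > 0, depending only on Σ, y, d and ε but not on s, such that for every s > 0, with V_s ~ N(0, sΣ): c₁ · s^{−d/2} · exp(−‖y‖²/s) ≤ E[(2πs)^{−d/2} exp(−‖y − V_s‖²/(2s))] ≤ c₂ · s^{−d/2} · exp(−(ε/(2(ε+1))) · ‖y‖²/s). -/

import Mathlib

open MeasureTheory Real Matrix
open scoped ENNReal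

noncomputable section

/-- Euclidean norm on `Fin d → ℝ`. -/
def eucNorm {d : ℕ} (v : Fin d → ℝ) : ℝ := Real.sqrt (∑ i, (v i) ^ 2)

/-- Density of the multivariate Gaussian `N(m, C)` on `ℝ^d`. -/
def gaussianPdf {d : ℕ} (m : Fin d → ℝ) (C : Matrix (Fin d) (Fin d) ℝ)
    (z : Fin d → ℝ) : ℝ :=
  (Real.sqrt ((2 * π) ^ d * C.det))⁻¹ *
    Real.exp (-(1 / 2) * ((z - m) ⬝ᵥ (C⁻¹ *ᵥ (z - m))))

/-- The multivariate Gaussian measure `N(m, C)` on `ℝ^d`. -/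
def multivariateGaussian {d : ℕ} (m : Fin d → ℝ) (C : Matrix (Fin d) (Fin d) ℝ) :
    Measure (Fin d → ℝ) :=
  volume.withDensity fun z => ENNReal.ofReal (gaussianPdf m C z)

/-- Operator norm of a square matrix (as an operator on Euclidean space);
for a symmetric positive definite matrix this is the largest eigenvalue. -/
def matOpNorm {k : ℕ} (A : Matrix (Fin k) (Fin k) ℝ) : ℝ :=
  sSup {c : ℝ | ∃ v : Fin k → ℝ, eucNorm v = 1 ∧ c = eucNorm (A *ᵥ v)}

theorem eucNorm_eq_norm_toLp {d : ℕ} (v : Fin d → ℝ) : eucNorm v = ‖WithLp.toLp 2 v‖ := by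
  simp [eucNorm, EuclideanSpace.norm_eq]

theorem eucNorm_sq {d : ℕ} (v : Fin d → ℝ) : eucNorm v ^ 2 = ∑ i, v i ^ 2 :=
  Real.sq_sqrt (Finset.sum_nonneg fun _ _ => sq_nonneg _)

theorem eucNorm_sq_eq_dotProduct {d : ℕ} (v : Fin d → ℝ) : eucNorm v ^ 2 = v ⬝ᵥ v := by
  rw [eucNorm_sq]
  simp only [dotProduct, sq]

theorem eucNorm_nonneg {d : ℕ} (v : Fin d → ℝ) : 0 ≤ eucNorm v := Real.sqrt_nonneg _

theorem continuous_eucNorm {d : ℕ} : Continuous (eucNorm : (Fin d → ℝ) → ℝ) := by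
  unfold eucNorm
  fun_prop

theorem eucNorm_smul {d : ℕ} (c : ℝ) (v : Fin d → ℝ) : eucNorm (c • v) = |c| * eucNorm v := by
  simp [eucNorm_eq_norm_toLp, norm_smul]

theorem eucNorm_mulVec_le {d : ℕ} (A : Matrix (Fin d) (Fin d) ℝ) (v : Fin d → ℝ) :
    eucNorm (A *ᵥ v) ≤ matOpNorm A * eucNorm v := by
  have hbdd : BddAbove {c : ℝ | ∃ v : Fin d → ℝ, eucNorm v = 1 ∧ c = eucNorm (A *ᵥ v)} := by
    refine ⟨‖toEuclideanCLM (n := Fin d) (𝕜 := ℝ) A‖, ?_⟩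
    rintro c ⟨v, hv, rfl⟩
    rw [eucNorm_eq_norm_toLp] at hv ⊢
    simpa [hv] using (toEuclideanCLM (n := Fin d) (𝕜 := ℝ) A).le_opNorm (WithLp.toLp 2 v)
  rcases (eucNorm_nonneg v).eq_or_lt with h | h
  · have hv : v = 0 := by
      rw [eucNorm_eq_norm_toLp] at h
      simpa using h.symm
    simp [hv, eucNorm]
  · have h1 : eucNorm ((eucNorm v)⁻¹ • v) = 1 := by
      rw [eucNorm_smul, abs_of_pos (inv_pos.2 h), inv_mul_cancel₀ h.ne']
    have h2 := le_csSup hbdd ⟨_, h1, rfl⟩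
    rw [mulVec_smul, eucNorm_smul, abs_of_pos (inv_pos.2 h), inv_mul_le_iff₀ h] at h2
    rwa [mul_comm]

theorem dotProduct_mulVec_le_matOpNorm {d : ℕ} (A : Matrix (Fin d) (Fin d) ℝ) (v : Fin d → ℝ) :
    v ⬝ᵥ (A *ᵥ v) ≤ matOpNorm A * eucNorm v ^ 2 := by
  calc v ⬝ᵥ (A *ᵥ v) ≤ eucNorm v * eucNorm (A *ᵥ v) := by
        have h := real_inner_le_norm (WithLp.toLp 2 (A *ᵥ v)) (WithLp.toLp 2 v)
        rw [EuclideanSpace.inner_toLp_toLp, ← eucNorm_eq_norm_toLp, ← eucNorm_eq_norm_toLp,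
          mul_comm] at h
        simpa using h
    _ ≤ eucNorm v * (matOpNorm A * eucNorm v) :=
        mul_le_mul_of_nonneg_left (eucNorm_mulVec_le A v) (eucNorm_nonneg v)
    _ = matOpNorm A * eucNorm v ^ 2 := by ring

/-- The inverse of a positive definite matrix is bounded below by the inverse of its operator
norm. -/
theorem inv_matOpNorm_mul_le_dotProduct_inv {d : ℕ} {S : Matrix (Fin d) (Fin d) ℝ}
    (hS : S.PosDef) (hN : 0 < matOpNorm S) (w : Fin d → ℝ) :
    (matOpNorm S)⁻¹ * eucNorm w ^ 2 ≤ w ⬝ᵥ (S⁻¹ *ᵥ w) := by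
  have hdet : IsUnit S.det := hS.det_pos.ne'.isUnit
  set N := matOpNorm S
  set u := S⁻¹ *ᵥ w with hu
  have hSu : S *ᵥ u = w := by rw [hu, mulVec_mulVec, mul_nonsing_inv _ hdet, one_mulVec]
  have hsymm : u ⬝ᵥ (S *ᵥ w) = w ⬝ᵥ w := by
    have hT : Sᵀ = S := by simpa using hS.isHermitian.eq
    rw [dotProduct_mulVec, ← mulVec_transpose, hT, hSu]
  have h0 := hS.posSemidef.dotProduct_mulVec_nonneg (u - N⁻¹ • w)
  have h1 := dotProduct_mulVec_le_matOpNorm S w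
  simp only [star_trivial, mulVec_sub, mulVec_smul, hSu, sub_dotProduct, dotProduct_sub,
    smul_dotProduct, dotProduct_smul, smul_eq_mul, hsymm] at h0
  rw [dotProduct_comm u w] at h0
  rw [eucNorm_sq_eq_dotProduct] at h1 ⊢
  have h2 : N⁻¹ * (N⁻¹ * (w ⬝ᵥ (S *ᵥ w))) ≤ N⁻¹ * (w ⬝ᵥ w) := by
    have hi : 0 < N⁻¹ := inv_pos.2 hN
    refine mul_le_mul_of_nonneg_left ?_ hi.le
    rwa [inv_mul_le_iff₀ hN]
  linarith

theorem integrable_exp_neg_mul_eucNorm_sq {d : ℕ} {b : ℝ} (hb : 0 < b) :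
    Integrable fun w : Fin d → ℝ => Real.exp (-b * eucNorm w ^ 2) := by
  simp only [eucNorm_sq, Finset.mul_sum, Real.exp_sum]
  exact Integrable.fintype_prod fun _ => integrable_exp_neg_mul_sq hb

theorem continuous_gaussianPdf {d : ℕ} (m : Fin d → ℝ) (C : Matrix (Fin d) (Fin d) ℝ) :
    Continuous (gaussianPdf m C) := by
  unfold gaussianPdf
  fun_prop

theorem gaussianPdf_nonneg {d : ℕ} (m : Fin d → ℝ) (C : Matrix (Fin d) (Fin d) ℝ)
    (z : Fin d → ℝ) : 0 ≤ gaussianPdf m C z := by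
  unfold gaussianPdf
  positivity

theorem integral_multivariateGaussian {d : ℕ} (m : Fin d → ℝ) (C : Matrix (Fin d) (Fin d) ℝ)
    (g : (Fin d → ℝ) → ℝ) :
    ∫ v, g v ∂(multivariateGaussian m C) = ∫ v, gaussianPdf m C v * g v := by
  rw [multivariateGaussian, integral_withDensity_eq_integral_toReal_smul
    (continuous_gaussianPdf m C).measurable.ennreal_ofReal (by simp)]
  simp [ENNReal.toReal_ofReal (gaussianPdf_nonneg m C _)]

theorem gaussianPdf_smul_sqrt_smul {d : ℕ} {S : Matrix (Fin d) (Fin d) ℝ} (hS : S.PosDef)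
    {s : ℝ} (hs : 0 < s) (w : Fin d → ℝ) :
    gaussianPdf 0 (s • S) (√s • w) = (√s ^ d)⁻¹ * gaussianPdf 0 S w := by
  have hdet : IsUnit S.det := hS.det_pos.ne'.isUnit
  have hinv : (s • S)⁻¹ = s⁻¹ • S⁻¹ := by
    exact inv_smul' S (Units.mk0 s hs.ne') hdet
  have hsq : √((2 * π) ^ d * (s ^ d * S.det)) = √s ^ d * √((2 * π) ^ d * S.det) := by
    rw [mul_left_comm, Real.sqrt_mul (by positivity)]
    congr 1
    rw [Real.sqrt_eq_iff_mul_self_eq (by positivity) (by positivity), ← mul_pow,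
      Real.mul_self_sqrt hs.le]
  have hq : (√s • w) ⬝ᵥ ((s • S)⁻¹ *ᵥ (√s • w)) = w ⬝ᵥ (S⁻¹ *ᵥ w) := by
    simp only [hinv, smul_mulVec, mulVec_smul, smul_dotProduct, dotProduct_smul, smul_eq_mul]
    have h := Real.mul_self_sqrt hs.le
    calc √s * (s⁻¹ * (√s * (w ⬝ᵥ (S⁻¹ *ᵥ w)))) = (√s * √s) * s⁻¹ * (w ⬝ᵥ (S⁻¹ *ᵥ w)) := by ring
      _ = _ := by rw [h, mul_inv_cancel₀ hs.ne', one_mul]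
  simp only [gaussianPdf, sub_zero, hq, det_smul, Fintype.card_fin, hsq, mul_inv]
  ring

theorem integral_multivariateGaussian_smul {d : ℕ} {S : Matrix (Fin d) (Fin d) ℝ}
    (hS : S.PosDef) {s : ℝ} (hs : 0 < s) (g : (Fin d → ℝ) → ℝ) :
    ∫ v, g v ∂(multivariateGaussian 0 (s • S)) = ∫ w, gaussianPdf 0 S w * g (√s • w) := by
  have hpos : 0 < √s ^ d := pow_pos (Real.sqrt_pos.2 hs) d
  have h := Measure.integral_comp_smul (volume : Measure (Fin d → ℝ))
    (fun v => gaussianPdf 0 (s • S) v * g v) √s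
  simp only [gaussianPdf_smul_sqrt_smul hS hs, mul_assoc, integral_const_mul,
    Module.finrank_fintype_fun_eq_card, Fintype.card_fin, smul_eq_mul,
    abs_of_pos (inv_pos.2 hpos)] at h
  rw [integral_multivariateGaussian]
  exact (mul_left_cancel₀ (inv_pos.2 hpos).ne' h).symm

theorem eucNorm_sub_sqrt_smul_sq_le {d : ℕ} {s : ℝ} (hs : 0 ≤ s) (y w : Fin d → ℝ) :
    eucNorm (y - √s • w) ^ 2 ≤ 2 * eucNorm y ^ 2 + 2 * s * eucNorm w ^ 2 := by
  simp only [eucNorm_sq, Finset.mul_sum, ← Finset.sum_add_distrib]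
  refine Finset.sum_le_sum fun i _ => ?_
  simp only [Pi.sub_apply, Pi.smul_apply, smul_eq_mul]
  nlinarith [sq_nonneg (y i + √s * w i), Real.mul_self_sqrt hs]

theorem div_mul_eucNorm_sq_le {d : ℕ} {s ε : ℝ} (hs : 0 ≤ s) (hε : 0 < ε) (y w : Fin d → ℝ) :
    ε / (ε + 1) * eucNorm y ^ 2 ≤ ε * s * eucNorm w ^ 2 + eucNorm (y - √s • w) ^ 2 := by
  simp only [eucNorm_sq, Finset.mul_sum, ← Finset.sum_add_distrib]
  refine Finset.sum_le_sum fun i _ => ?_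
  simp only [Pi.sub_apply, Pi.smul_apply, smul_eq_mul]
  have h : ε * s * w i ^ 2 = ε * (√s * w i) ^ 2 := by
    rw [mul_pow, Real.sq_sqrt hs, mul_assoc]
  rw [h, div_mul_eq_mul_div, div_le_iff₀ (by positivity)]
  nlinarith [sq_nonneg ((ε + 1) * (√s * w i) - y i)]

/-- Let `Σ` be symmetric positive definite, `y ∈ ℝ^d` and `0 < ε < 1/‖Σ‖_op`.
Then there are constants `c₁, c₂ > 0` independent of `s` such that for every `s > 0`,
with `V_s ~ N(0, sΣ)`,
`c₁ s^{−d/2} e^{−‖y‖²/s} ≤ E[(2πs)^{−d/2} e^{−‖y − V_s‖²/(2s)}]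
  ≤ c₂ s^{−d/2} e^{−(ε/(2(ε+1)))‖y‖²/s}`. -/
theorem gaussian_likelihood_expectation_bounds
    (d : ℕ) (S : Matrix (Fin d) (Fin d) ℝ) (hS : S.PosDef)
    (y : Fin d → ℝ) (ε : ℝ) (hε : 0 < ε) (hεop : ε < 1 / matOpNorm S) :
    ∃ c₁ > (0 : ℝ), ∃ c₂ > (0 : ℝ), ∀ s : ℝ, 0 < s →
      (c₁ * s ^ (-(d : ℝ) / 2) * Real.exp (-(eucNorm y ^ 2) / s) ≤
        ∫ v, (2 * π * s) ^ (-(d : ℝ) / 2) *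
            Real.exp (-(eucNorm (y - v) ^ 2) / (2 * s))
          ∂(multivariateGaussian (fun _ => 0) (s • S))) ∧
      (∫ v, (2 * π * s) ^ (-(d : ℝ) / 2) *
            Real.exp (-(eucNorm (y - v) ^ 2) / (2 * s))
          ∂(multivariateGaussian (fun _ => 0) (s • S))) ≤
        c₂ * s ^ (-(d : ℝ) / 2) *
          Real.exp (-(ε / (2 * (ε + 1))) * eucNorm y ^ 2 / s) := by
  have hN : 0 < matOpNorm S := one_div_pos.1 (hε.trans hεop)
  set lam := (matOpNorm S)⁻¹
  have hgap : 0 < (lam - ε) / 2 := by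
    rw [one_div] at hεop
    linarith
  have hq : ∀ w : Fin d → ℝ, lam * eucNorm w ^ 2 ≤ w ⬝ᵥ (S⁻¹ *ᵥ w) :=
    inv_matOpNorm_mul_le_dotProduct_inv hS hN
  have hlam0 : 0 < lam := inv_pos.2 hN
  set K := (√((2 * π) ^ d * S.det))⁻¹ with hK
  have hKpos : 0 < K := by
    have := hS.det_pos
    positivity
  have hPpos : 0 < (2 * π) ^ (-(d : ℝ) / 2) := by positivity
  have hlow_int : Integrable fun w : Fin d → ℝ =>
      Real.exp (-(1 / 2) * (w ⬝ᵥ (S⁻¹ *ᵥ w)) - eucNorm w ^ 2) := by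
    refine (integrable_exp_neg_mul_eucNorm_sq one_pos).mono'
      (Continuous.aestronglyMeasurable ?_) (ae_of_all _ fun w => ?_)
    · have := continuous_eucNorm (d := d)
      fun_prop
    · rw [Real.norm_eq_abs, abs_of_pos (Real.exp_pos _), Real.exp_le_exp]
      have := hq w
      have : 0 ≤ lam * eucNorm w ^ 2 := by positivity
      linarith
  have hup_int := integrable_exp_neg_mul_eucNorm_sq (d := d) hgap
  refine ⟨(2 * π) ^ (-(d : ℝ) / 2) * K * _, mul_pos (mul_pos hPpos hKpos)
      (integral_exp_pos hlow_int),
    (2 * π) ^ (-(d : ℝ) / 2) * K * _, mul_pos (mul_pos hPpos hKpos) (integral_exp_pos hup_int),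
    fun s hs => ?_⟩
  have hscale : ∫ v, (2 * π * s) ^ (-(d : ℝ) / 2) *
      Real.exp (-(eucNorm (y - v) ^ 2) / (2 * s)) ∂(multivariateGaussian (fun _ => 0) (s • S)) =
      (2 * π) ^ (-(d : ℝ) / 2) * K * s ^ (-(d : ℝ) / 2) * ∫ w : Fin d → ℝ,
        Real.exp (-(1 / 2) * (w ⬝ᵥ (S⁻¹ *ᵥ w)) - eucNorm (y - √s • w) ^ 2 / (2 * s)) := by
    refine (integral_multivariateGaussian_smul hS hs _).trans ?_
    rw [← integral_const_mul]
    refine integral_congr_ae (ae_of_all _ fun w => ?_)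
    simp only [gaussianPdf, sub_zero]
    rw [Real.mul_rpow (by positivity) hs.le, sub_eq_add_neg (-(1 / 2) * _), Real.exp_add,
      neg_div (2 * s), hK]
    ac_rfl
  have hlower : ∀ w : Fin d → ℝ,
      Real.exp (-(eucNorm y ^ 2) / s) *
          Real.exp (-(1 / 2) * (w ⬝ᵥ (S⁻¹ *ᵥ w)) - eucNorm w ^ 2) ≤
        Real.exp (-(1 / 2) * (w ⬝ᵥ (S⁻¹ *ᵥ w)) - eucNorm (y - √s • w) ^ 2 / (2 * s)) := by
    intro w
    rw [← Real.exp_add, Real.exp_le_exp]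
    have h : eucNorm (y - √s • w) ^ 2 / (2 * s) ≤ eucNorm y ^ 2 / s + eucNorm w ^ 2 := by
      rw [div_le_iff₀ (by positivity)]
      have h2 : (eucNorm y ^ 2 / s + eucNorm w ^ 2) * (2 * s) =
          2 * eucNorm y ^ 2 + 2 * s * eucNorm w ^ 2 := by
        field_simp
      rw [h2]
      exact eucNorm_sub_sqrt_smul_sq_le hs.le y w
    rw [neg_div]
    linarith
  have hupper : ∀ w : Fin d → ℝ,
      Real.exp (-(1 / 2) * (w ⬝ᵥ (S⁻¹ *ᵥ w)) - eucNorm (y - √s • w) ^ 2 / (2 * s)) ≤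
        Real.exp (-(ε / (2 * (ε + 1))) * eucNorm y ^ 2 / s) *
          Real.exp (-((lam - ε) / 2) * eucNorm w ^ 2) := by
    intro w
    rw [← Real.exp_add, Real.exp_le_exp]
    have h : ε / (2 * (ε + 1)) * eucNorm y ^ 2 / s ≤
        ε / 2 * eucNorm w ^ 2 + eucNorm (y - √s • w) ^ 2 / (2 * s) := by
      have h1 : ε / (2 * (ε + 1)) * eucNorm y ^ 2 / s =
          ε / (ε + 1) * eucNorm y ^ 2 / (2 * s) := by
        field_simp
      have h2 : ε / 2 * eucNorm w ^ 2 + eucNorm (y - √s • w) ^ 2 / (2 * s) =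
          (ε * s * eucNorm w ^ 2 + eucNorm (y - √s • w) ^ 2) / (2 * s) := by
        field_simp
      rw [h1, h2]
      exact div_le_div_of_nonneg_right (div_mul_eucNorm_sq_le hs.le hε y w) (by positivity)
    have h3 : -(ε / (2 * (ε + 1))) * eucNorm y ^ 2 / s =
        -(ε / (2 * (ε + 1)) * eucNorm y ^ 2 / s) := by ring
    rw [h3]
    linarith [hq w]
  have hmid_int : Integrable fun w : Fin d → ℝ =>
      Real.exp (-(1 / 2) * (w ⬝ᵥ (S⁻¹ *ᵥ w)) - eucNorm (y - √s • w) ^ 2 / (2 * s)) := by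
    refine (hup_int.const_mul (Real.exp (-(ε / (2 * (ε + 1))) * eucNorm y ^ 2 / s))).mono'
      (Continuous.aestronglyMeasurable ?_) (ae_of_all _ fun w => ?_)
    · have : Continuous fun w : Fin d → ℝ => eucNorm (y - √s • w) :=
        continuous_eucNorm.comp (by fun_prop)
      fun_prop
    · rw [Real.norm_eq_abs, abs_of_pos (Real.exp_pos _)]
      exact hupper w
  have hlow := integral_mono (hlow_int.const_mul _) hmid_int hlower
  have hup := integral_mono hmid_int (hup_int.const_mul _) hupper
  rw [integral_const_mul] at hlow hup
  have hc : 0 ≤ (2 * π) ^ (-(d : ℝ) / 2) * K * s ^ (-(d : ℝ) / 2) := by positivity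
  rw [hscale]
  constructor
  · refine le_of_eq_of_le ?_ (mul_le_mul_of_nonneg_left hlow hc)
    ring
  · refine (mul_le_mul_of_nonneg_left hup hc).trans_eq ?_
    ring

end
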